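/- (Postnikov's Corollary 6.5) Let G be the path on the ordered variable set V = {x_0, x_1, ..., x_n} with edges (x_i, x_{i+1}), 0 ≤ i ≤ n−1, let Φ = DS_G, and set y_i = x_0 + x_1 + ... + x_i. For any scalars z_0, ..., z_n, Φ( Σ_{i=0}^{n} (z_0 y_i + z_1 y_{i+1} + ... + z_n y_{i+n})^n ) = n! · (z_0 + z_1 + ... + z_n)^n, where the indices of y are taken modulo n+1. -/

import Mathlib

open MvPolynomial

/-- Partial divided symmetrization of a polynomial `f` over the graph on the variables
`x_0 < x_1 < ... < x_{m-1}` whose (ordered) edges form the finset `E`: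
`DS_G(f) = Σ_π (f ∘ π) / Π_{(x,y) ∈ E} (x_π − y_π)`,
the sum being over all `m!` permutations of the variables. -/
noncomputable def DS {K : Type*} [Field K] {m : ℕ} (E : Finset (Fin m × Fin m))
    (f : MvPolynomial (Fin m) K) : FractionRing (MvPolynomial (Fin m) K) :=
  ∑ π : Equiv.Perm (Fin m),
    algebraMap (MvPolynomial (Fin m) K) (FractionRing (MvPolynomial (Fin m) K))
        (rename (⇑π) f) /
      algebraMap (MvPolynomial (Fin m) K) (FractionRing (MvPolynomial (Fin m) K))
        (rename (⇑π) (∏ e ∈ E, (X e.1 - X e.2)))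

/-- The edge set of the path `x_0 — x_1 — ⋯ — x_n`: the pairs `(x_i, x_{i+1})`,
`0 ≤ i ≤ n−1`. -/
def pathEdges (n : ℕ) : Finset (Fin (n + 1) × Fin (n + 1)) :=
  Finset.univ.image fun i : Fin n => (i.castSucc, i.succ)

/-- `pathY n K k = y_k = x_0 + x_1 + ⋯ + x_k`. -/
noncomputable def pathY (n : ℕ) (K : Type*) [Field K] (k : Fin (n + 1)) :
    MvPolynomial (Fin (n + 1)) K :=
  ∑ j ∈ Finset.Iic k, X j

/-- The divided symmetrization as a linear map. -/
noncomputable def dsLinear {K : Type*} [Field K] {m : ℕ} (E : Finset (Fin m × Fin m)) :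
    MvPolynomial (Fin m) K →ₗ[K] FractionRing (MvPolynomial (Fin m) K) where
  toFun := DS E
  map_add' f g := by simp [DS, add_div, Finset.sum_add_distrib]
  map_smul' c f := by
    rw [RingHom.id_apply, DS, DS, Finset.smul_sum]
    refine Finset.sum_congr rfl fun π _ => ?_
    rw [smul_eq_C_mul, map_mul, rename_C, map_mul, mul_div_assoc, Algebra.smul_def,
      IsScalarTower.algebraMap_apply K (MvPolynomial (Fin m) K), algebraMap_eq]

lemma dsLinear_apply {K : Type*} [Field K] {m : ℕ} (E : Finset (Fin m × Fin m))
    (f : MvPolynomial (Fin m) K) : dsLinear E f = DS E f := rfl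

/-- The alternating sum of a polynomial over all permutations of its variables. -/
noncomputable def alternate {K : Type*} [Field K] {m : ℕ} :
    MvPolynomial (Fin m) K →ₗ[K] MvPolynomial (Fin m) K :=
  ∑ π : Equiv.Perm (Fin m), (Equiv.Perm.sign π : ℤ) • (rename ⇑π).toLinearMap

lemma alternate_apply {K : Type*} [Field K] {m : ℕ} (q : MvPolynomial (Fin m) K) :
    alternate q = ∑ π : Equiv.Perm (Fin m), (Equiv.Perm.sign π : ℤ) • rename (⇑π) q := by
  simp [alternate]

lemma alternate_eq_zero_of_swap {K : Type*} [Field K] {m : ℕ} {q : MvPolynomial (Fin m) K}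
    {a b : Fin m} (hab : a ≠ b) (h : rename (⇑(Equiv.swap a b)) q = q) : alternate q = 0 := by
  rw [alternate_apply]
  refine Finset.sum_involution (fun π _ => π * Equiv.swap a b) ?_ ?_ ?_ ?_
  · intro π _
    have : rename (⇑(π * Equiv.swap a b)) q = rename (⇑π) q := by
      conv_rhs => rw [← h]
      rw [rename_rename]; rfl
    rw [this, Equiv.Perm.sign_mul, Equiv.Perm.sign_swap hab]
    simp
  · intro π _ _ h'
    have := mul_eq_left.1 h'
    exact hab (Equiv.swap_eq_one_iff.1 this)
  · simp
  · intro π _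
    simp [mul_assoc]

lemma rename_swap_monomial {K : Type*} [Field K] {m : ℕ} {s : Fin m →₀ ℕ} {a b : Fin m}
    (h : s a = s b) (r : K) :
    rename (⇑(Equiv.swap a b)) (monomial s r) = monomial s r := by
  rw [rename_monomial]
  refine congrArg (fun s => monomial s r) ?_
  rw [← Finsupp.equivMapDomain_eq_mapDomain]
  ext c
  rw [Finsupp.equivMapDomain_apply, Equiv.symm_swap]
  rcases eq_or_ne c a with rfl | hca
  · simp [h]
  rcases eq_or_ne c b with rfl | hcb
  · simp [h]
  · rw [Equiv.swap_apply_of_ne_of_ne hca hcb]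

/-- The pairs `a < b` on the same side of the threshold `t`. -/
def samePairs (m t : ℕ) : Finset (Fin m × Fin m) :=
  Finset.univ.filter fun p => p.1 < p.2 ∧ (p.1.val ≤ t ↔ p.2.val ≤ t)

/-- The pairs `a ≤ t < b`. -/
def crossPairs (m t : ℕ) : Finset (Fin m × Fin m) :=
  Finset.univ.filter fun p => p.1.val ≤ t ∧ ¬ p.2.val ≤ t

lemma card_samePairs_le {m t : ℕ} (s : Fin m → ℕ)
    (hs : ∀ a b, a ≠ b → (a.val ≤ t ↔ b.val ≤ t) → s a ≠ s b) :
    (samePairs m t).card ≤ ∑ a, s a := by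
  classical
  set D : Finset (Fin m × Fin m) :=
    Finset.univ.filter fun p => s p.2 < s p.1 ∧ (p.1.val ≤ t ↔ p.2.val ≤ t) with hD
  have h1 : (samePairs m t).card ≤ D.card := by
    refine Finset.card_le_card_of_injOn
      (fun p => if s p.2 < s p.1 then p else p.swap) ?_ ?_
    · rintro ⟨a, b⟩ hp
      simp only [samePairs, Finset.coe_filter, Finset.mem_univ, true_and, Set.mem_ofPred_eq] at hp
      have := hs a b hp.1.ne hp.2
      simp only [hD, Finset.coe_filter, Finset.mem_univ, true_and, Set.mem_ofPred_eq]
      split_ifs with h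
      · exact ⟨h, hp.2⟩
      · exact ⟨by simp at h ⊢; omega, hp.2.symm⟩
    · rintro ⟨a, b⟩ hp ⟨c, d⟩ hq h
      simp only [samePairs, Finset.coe_filter, Finset.mem_univ, true_and, Set.mem_ofPred_eq] at hp hq
      have h1 := hp.1
      have h2 := hq.1
      dsimp only at h
      split_ifs at h <;> simp only [Prod.swap_prod_mk, Prod.mk.injEq] at h ⊢ <;>
        obtain ⟨rfl, rfl⟩ := h <;> first | exact ⟨rfl, rfl⟩ | exact absurd h1 h2.not_gt
  refine h1.trans ?_
  have h2 : D.card = ∑ a, (D.filter fun p => p.1 = a).card :=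
    Finset.card_eq_sum_card_fiberwise (fun _ _ => Finset.mem_coe.2 (Finset.mem_univ _))
  rw [h2]
  refine Finset.sum_le_sum fun a _ => ?_
  rw [← Finset.card_range (s a)]
  refine Finset.card_le_card_of_injOn (fun p => s p.2) ?_ ?_
  · rintro ⟨c, d⟩ hp
    simp only [hD, Finset.coe_filter, Finset.mem_filter, Finset.mem_univ, true_and,
      Set.mem_ofPred_eq] at hp
    simpa [← hp.2] using hp.1.1
  · rintro ⟨c, d⟩ hp ⟨c', d'⟩ hq h
    simp only [hD, Finset.coe_filter, Finset.mem_filter, Finset.mem_univ, true_and,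
      Set.mem_ofPred_eq] at hp hq
    obtain ⟨hp, rfl⟩ := hp
    obtain ⟨hq, rfl⟩ := hq
    by_contra hne
    exact hs d d' (fun h => hne (by rw [h])) (hp.2.symm.trans hq.2) h

lemma alternate_mul_eq_zero {K : Type*} [Field K] {m t : ℕ} {P q : MvPolynomial (Fin m) K}
    (hP : ∀ σ : Equiv.Perm (Fin m), (∀ a, (σ a).val ≤ t ↔ a.val ≤ t) → rename (⇑σ) P = P)
    (hq : q.totalDegree < (samePairs m t).card) : alternate (P * q) = 0 := by
  rw [q.as_sum, Finset.mul_sum, map_sum]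
  refine Finset.sum_eq_zero fun s hs => ?_
  have hdeg : ∑ a, s a < (samePairs m t).card := by
    refine lt_of_le_of_lt ?_ hq
    have := le_totalDegree hs
    rwa [Finsupp.sum_fintype _ _ (fun _ => rfl)] at this
  obtain ⟨a, b, hab, hc, hsab⟩ :
      ∃ a b, a ≠ b ∧ (a.val ≤ t ↔ b.val ≤ t) ∧ s a = s b := by
    by_contra! h
    exact hdeg.not_ge (card_samePairs_le s h)
  refine alternate_eq_zero_of_swap hab ?_
  rw [map_mul, rename_swap_monomial hsab, hP]
  intro c
  rcases eq_or_ne c a with rfl | hca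
  · simp [hc]
  rcases eq_or_ne c b with rfl | hcb
  · simp [hc]
  · rw [Equiv.swap_apply_of_ne_of_ne hca hcb]

/-- The product of the differences `X a - X b` over a set of pairs `(a, b)`. -/
noncomputable def diffProd (K : Type*) [Field K] {m : ℕ} (E : Finset (Fin m × Fin m)) :
    MvPolynomial (Fin m) K :=
  ∏ e ∈ E, (X e.1 - X e.2)

lemma diffProd_ne_zero (K : Type*) [Field K] {m : ℕ} {E : Finset (Fin m × Fin m)}
    (hE : ∀ e ∈ E, e.1 < e.2) : diffProd K E ≠ 0 := by
  refine Finset.prod_ne_zero_iff.2 fun e he => ?_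
  rw [sub_ne_zero]
  exact fun h => (hE e he).ne (X_injective h)

lemma totalDegree_diffProd_le (K : Type*) [Field K] {m : ℕ} (E : Finset (Fin m × Fin m)) :
    (diffProd K E).totalDegree ≤ E.card := by
  refine (totalDegree_finsetProd _ _).trans ?_
  refine (Finset.sum_le_card_nsmul _ _ 1 fun e _ => ?_).trans (by simp)
  exact (totalDegree_sub _ _).trans (by simp)

lemma rename_diffProd_cross (K : Type*) [Field K] {m t : ℕ} (σ : Equiv.Perm (Fin m))
    (hσ : ∀ a, (σ a).val ≤ t ↔ a.val ≤ t) :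
    rename (⇑σ) (diffProd K (crossPairs m t)) = diffProd K (crossPairs m t) := by
  rw [diffProd, map_prod]
  refine Finset.prod_equiv (σ.prodCongr σ) ?_ ?_
  · rintro ⟨a, b⟩
    simp only [crossPairs, Finset.mem_filter, Finset.mem_univ, true_and, Equiv.prodCongr_apply,
      Prod.map, hσ]
  · rintro ⟨a, b⟩ _
    simp

lemma diffProd_same_mul_cross (K : Type*) [Field K] (m t : ℕ) :
    diffProd K (samePairs m t) * diffProd K (crossPairs m t) =
      (Matrix.vandermonde fun i : Fin m => -(X i : MvPolynomial (Fin m) K)).det := by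
  rw [Matrix.det_vandermonde, Finset.prod_sigma', diffProd, diffProd, ← Finset.prod_union]
  · refine Finset.prod_bij' (fun p _ => ⟨p.1, p.2⟩) (fun p _ => (p.1, p.2)) ?_ ?_ ?_ ?_ ?_
    · rintro ⟨a, b⟩ hp
      simp only [samePairs, crossPairs, Finset.mem_union, Finset.mem_filter, Finset.mem_univ,
        true_and] at hp
      simp only [Finset.mem_sigma, Finset.mem_univ, Finset.mem_Ioi, true_and, Fin.lt_def]
      rw [Fin.lt_def] at hp
      omega
    · rintro ⟨a, b⟩ hp
      simp only [Finset.mem_sigma, Finset.mem_univ, Finset.mem_Ioi, true_and, Fin.lt_def] at hp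
      simp only [samePairs, crossPairs, Finset.mem_union, Finset.mem_filter, Finset.mem_univ,
        true_and]
      rw [Fin.lt_def]
      omega
    · simp
    · simp
    · intros; ring
  · rw [Finset.disjoint_left]
    rintro ⟨a, b⟩ h1 h2
    simp only [samePairs, crossPairs, Finset.mem_filter, Finset.mem_univ, true_and] at h1 h2
    tauto

lemma rename_vandermonde (K : Type*) [Field K] {m : ℕ} (π : Equiv.Perm (Fin m)) :
    rename (⇑π) (Matrix.vandermonde fun i : Fin m => -(X i : MvPolynomial (Fin m) K)).det =
      (Equiv.Perm.sign π : ℤ) •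
        (Matrix.vandermonde fun i : Fin m => -(X i : MvPolynomial (Fin m) K)).det := by
  rw [zsmul_eq_mul, ← Matrix.det_permute, AlgHom.map_det]
  congr 1
  ext i j : 2
  simp [Matrix.vandermonde_apply]

/-- Divided symmetrization kills `P * g` when `g` has fewer degrees than there are edges and `P` is
symmetric under the permutations preserving the two sides of a threshold that no edge crosses. -/
lemma DS_mul_eq_zero {K : Type*} [Field K] {m : ℕ} (t : ℕ) {E : Finset (Fin m × Fin m)}
    (hE : ∀ e ∈ E, e.1 < e.2 ∧ (e.1.val ≤ t ↔ e.2.val ≤ t)) {P g : MvPolynomial (Fin m) K}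
    (hP : ∀ σ : Equiv.Perm (Fin m), (∀ a, (σ a).val ≤ t ↔ a.val ≤ t) → rename (⇑σ) P = P)
    (hg : g.totalDegree < E.card) : DS E (P * g) = 0 := by
  classical
  have hsub : E ⊆ samePairs m t := fun e he => by simpa [samePairs] using hE e he
  set Q := diffProd K (samePairs m t \ E) with hQ
  set R := diffProd K (crossPairs m t) with hR
  set V := (Matrix.vandermonde fun i : Fin m => -(X i : MvPolynomial (Fin m) K)).det with hV
  have hfac : V = diffProd K E * Q * R := by
    rw [hV, ← diffProd_same_mul_cross K m t, ← Finset.union_sdiff_of_subset hsub, diffProd,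
      Finset.prod_union Finset.disjoint_sdiff]
    simp only [hQ, hR, diffProd]
  have hne : V ≠ 0 := by
    rw [hV, ← diffProd_same_mul_cross K m t]
    refine mul_ne_zero (diffProd_ne_zero K fun e he => ?_) (diffProd_ne_zero K fun e he => ?_)
    · exact (Finset.mem_filter.1 he).2.1
    · have := (Finset.mem_filter.1 he).2
      rw [Fin.lt_def]
      omega
  have halt : alternate (P * R * (Q * g)) = 0 := by
    refine alternate_mul_eq_zero (t := t) (fun σ hσ => ?_) ?_
    · rw [map_mul, hP σ hσ, rename_diffProd_cross K σ hσ]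
    · have h1 := totalDegree_mul Q g
      have h2 : Q.totalDegree ≤ (samePairs m t \ E).card := totalDegree_diffProd_le K _
      have h3 := Finset.card_sdiff_add_card_eq_card hsub
      omega
  have key : algebraMap _ (FractionRing (MvPolynomial (Fin m) K)) V * DS E (P * g) =
      algebraMap _ _ (alternate (P * R * (Q * g))) := by
    rw [DS, alternate_apply, map_sum, Finset.mul_sum]
    refine Finset.sum_congr rfl fun π _ => ?_
    have hden : algebraMap (MvPolynomial (Fin m) K) (FractionRing (MvPolynomial (Fin m) K))
        (rename (⇑π) (diffProd K E)) ≠ 0 := by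
      rw [Ne, FaithfulSMul.algebraMap_eq_zero_iff,
        map_eq_zero_iff _ (rename_injective _ π.injective)]
      exact diffProd_ne_zero K fun e he => (hE e he).1
    have hs : V = (Equiv.Perm.sign π : ℤ) • rename (⇑π) V := by
      rw [hV, rename_vandermonde, smul_smul, ← Units.val_mul, Int.units_mul_self]
      simp
    rw [← mul_div_assoc, div_eq_iff (by exact hden), hs, hfac, ← diffProd]
    simp only [map_mul, zsmul_eq_mul, map_intCast]
    ring
  rw [halt, map_zero, mul_eq_zero, FaithfulSMul.algebraMap_eq_zero_iff] at key
  exact key.resolve_left hne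

lemma DS_insert {K : Type*} [Field K] {m : ℕ} {E : Finset (Fin m × Fin m)} {e : Fin m × Fin m}
    (he : e ∉ E) (hlt : e.1 < e.2) (f : MvPolynomial (Fin m) K) :
    DS (insert e E) ((X e.1 - X e.2) * f) = DS E f := by
  refine Finset.sum_congr rfl fun π _ => ?_
  rw [Finset.prod_insert he, map_mul, map_mul, map_mul, map_mul, mul_div_mul_left]
  rw [Ne, FaithfulSMul.algebraMap_eq_zero_iff, map_eq_zero_iff _ (rename_injective _ π.injective),
    sub_eq_zero]
  exact fun h => hlt.ne (X_injective h)

lemma eq_zero_of_harmonic {L : Type*} [Field L] [CharZero L] (N : ℕ) :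
    ∀ u : ℕ → L, u 0 = 0 → u N = 0 →
      (∀ t, t + 1 < N → u (t + 1) = 0 ∨ 2 * u (t + 1) = u t + u (t + 2)) →
      ∀ t ≤ N, u t = 0 := by
  classical
  induction N with
  | zero =>
    intro u h0 _ _ t ht
    rwa [Nat.le_zero.1 ht]
  | succ M ih =>
    intro u h0 hN hu
    have h1 : u 1 = 0 := by
      by_contra hne
      have hex : ∃ t, u (t + 1) = 0 := ⟨M, hN⟩
      have hle : Nat.find hex ≤ M := Nat.find_min' hex hN
      have hlin : ∀ s, s ≤ Nat.find hex →
          u s = s * u 1 ∧ u (s + 1) = ((s + 1 : ℕ) : L) * u 1 := by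
        intro s
        induction s with
        | zero => intro _; simp [h0]
        | succ s ihs =>
          intro hs
          obtain ⟨e1, e2⟩ := ihs (by omega)
          refine ⟨e2, ?_⟩
          have := (hu s (by omega)).resolve_left (Nat.find_min hex (by omega))
          have e3 : u (s + 1 + 1) = 2 * u (s + 1) - u s := by rw [this]; ring
          rw [e3, e2, e1]
          push_cast
          ring
      have h := (hlin _ le_rfl).2
      rw [Nat.find_spec hex] at h
      exact mul_ne_zero (Nat.cast_ne_zero.2 (Nat.succ_ne_zero _)) hne h.symm
    intro t ht
    cases t with
    | zero => exact h0
    | succ t =>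
      exact ih (fun t => u (t + 1)) h1 hN (fun t ht => hu (t + 1) (by omega)) t (by omega)

/-- A function on a cycle that is harmonic wherever it differs from a value it attains is
constant. -/
lemma eq_of_harmonic_cycle {L : Type*} [Field L] [CharZero L] {n : ℕ} {h : Fin (n + 1) → L} {A : L}
    {p : Fin (n + 1)} (hp : h p = A)
    (hh : ∀ j, h j = A ∨ 2 * h j = h (j - 1) + h (j + 1)) (j : Fin (n + 1)) : h j = A := by
  have hsucc (t : ℕ) : p + Fin.ofNat (n + 1) (t + 1) = p + Fin.ofNat (n + 1) t + 1 := by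
    rw [add_assoc]
    congr 1
    ext
    simp [Fin.val_add]
  have key := eq_zero_of_harmonic (n + 1) (fun t => h (p + Fin.ofNat (n + 1) t) - A)
    (by simp [hp]) (by simp [Fin.ofNat, hp]) (fun t _ => by
      rcases hh (p + Fin.ofNat (n + 1) (t + 1)) with h1 | h1
      · left; rw [h1, sub_self]
      · right
        rw [mul_sub, h1, ← hsucc, hsucc t, add_sub_cancel_right]
        ring) (j - p).val (j - p).isLt.le
  simpa [sub_eq_zero] using key

/-- The edges `x_i — x_{i+1}` of the path with `i + 1 ≤ k`. -/
def initialEdges (n k : ℕ) : Finset (Fin (n + 1) × Fin (n + 1)) :=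
  Finset.univ.filter fun e => e.2.val = e.1.val + 1 ∧ e.2.val ≤ k

lemma pathEdges_eq_initialEdges (n : ℕ) : pathEdges n = initialEdges n n := by
  ext ⟨a, b⟩
  simp only [pathEdges, initialEdges, Finset.mem_image, Finset.mem_univ, true_and,
    Finset.mem_filter, Prod.mk.injEq]
  constructor
  · rintro ⟨i, rfl, rfl⟩
    simp
  · rintro ⟨h1, h2⟩
    exact ⟨⟨a.val, by omega⟩, by ext; simp, by ext; simp [h1]⟩

lemma initialEdges_succ {n k : ℕ} (hk : k + 1 ≤ n) :
    initialEdges n (k + 1) =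
      insert (Fin.ofNat (n + 1) k, Fin.ofNat (n + 1) (k + 1)) (initialEdges n k) := by
  ext ⟨a, b⟩
  have h1 : k % (n + 1) = k := Nat.mod_eq_of_lt (by omega)
  have h2 : (k + 1) % (n + 1) = k + 1 := Nat.mod_eq_of_lt (by omega)
  simp only [initialEdges, Finset.mem_filter, Finset.mem_univ, true_and, Finset.mem_insert,
    Prod.mk.injEq, Fin.ext_iff, Fin.val_ofNat, h1, h2]
  omega

lemma initialEdges_zero (n : ℕ) : initialEdges n 0 = ∅ := by
  ext ⟨a, b⟩
  simp only [initialEdges, Finset.mem_filter, Finset.mem_univ, true_and, Finset.notMem_empty,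
    iff_false]
  omega

lemma card_initialEdges {n k : ℕ} (hk : k ≤ n) : (initialEdges n k).card = k := by
  induction k with
  | zero => simp [initialEdges_zero]
  | succ k ih =>
    rw [initialEdges_succ hk, Finset.card_insert_of_notMem, ih (by omega)]
    have h2 : (k + 1) % (n + 1) = k + 1 := Nat.mod_eq_of_lt (by omega)
    simp [initialEdges, h2]

section PathY

variable {K : Type*} [Field K] {n : ℕ}

lemma totalDegree_pathY_le (k : Fin (n + 1)) : (pathY n K k).totalDegree ≤ 1 :=
  totalDegree_finsetSum_le fun _ _ => (totalDegree_X _).le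

lemma totalDegree_prod_pathY_le {ι : Type*} (s : Finset ι) (v : ι → Fin (n + 1)) :
    (∏ k ∈ s, pathY n K (v k)).totalDegree ≤ s.card := by
  refine (totalDegree_finsetProd _ _).trans ?_
  exact (Finset.sum_le_card_nsmul _ _ 1 fun k _ => totalDegree_pathY_le _).trans (by simp)

lemma rename_pathY {k : Fin (n + 1)} {σ : Equiv.Perm (Fin (n + 1))}
    (hσ : ∀ a, (σ a).val ≤ k.val ↔ a.val ≤ k.val) : rename (⇑σ) (pathY n K k) = pathY n K k := by
  rw [pathY, map_sum]
  refine Finset.sum_equiv σ (fun a => ?_) (fun a _ => by simp)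
  rw [Finset.mem_Iic, Finset.mem_Iic, Fin.le_def, Fin.le_def, hσ]

lemma pathY_zero : pathY n K 0 = X 0 := by
  have : Finset.Iic (0 : Fin (n + 1)) = {0} := by ext; simp
  simp [pathY, this]

lemma pathY_succ {k : ℕ} (hk : k + 1 ≤ n) :
    pathY n K (Fin.ofNat (n + 1) (k + 1)) =
      pathY n K (Fin.ofNat (n + 1) k) + X (Fin.ofNat (n + 1) (k + 1)) := by
  have h1 : k % (n + 1) = k := Nat.mod_eq_of_lt (by omega)
  have h2 : (k + 1) % (n + 1) = k + 1 := Nat.mod_eq_of_lt (by omega)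
  have : Finset.Iic (Fin.ofNat (n + 1) (k + 1)) =
      insert (Fin.ofNat (n + 1) (k + 1)) (Finset.Iic (Fin.ofNat (n + 1) k)) := by
    ext a
    simp only [Finset.mem_Iic, Finset.mem_insert, Fin.le_def, Fin.ext_iff, Fin.val_ofNat, h1, h2]
    omega
  rw [pathY, this, Finset.sum_insert, pathY]
  · exact add_comm _ _
  · simp only [Finset.mem_Iic, Fin.le_def, Fin.val_ofNat, h1, h2]
    omega

lemma DS_pathY_mul_eq_zero {k : ℕ} (hk : k ≤ n) {g : MvPolynomial (Fin (n + 1)) K}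
    (hg : g.totalDegree < k) :
    DS (initialEdges n k) (pathY n K (Fin.ofNat (n + 1) k) * g) = 0 := by
  have h1 : k % (n + 1) = k := Nat.mod_eq_of_lt (by omega)
  refine DS_mul_eq_zero k (fun e he => ?_) (fun σ hσ => rename_pathY ?_)
    (by rwa [card_initialEdges hk])
  · have := (Finset.mem_filter.1 he).2
    rw [Fin.lt_def]
    omega
  · simpa [h1] using hσ

/-- The defining relations of the Klyachko algebra. -/
lemma DS_pathY_mul_sub_mul_eq_zero {i k : ℕ} (hi : i < k) (hk : k ≤ n)
    {g : MvPolynomial (Fin (n + 1)) K} (hg : g.totalDegree + 1 < k) :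
    DS (initialEdges n k) (pathY n K (Fin.ofNat (n + 1) i) *
      (X (Fin.ofNat (n + 1) i) - X (Fin.ofNat (n + 1) (i + 1))) * g) = 0 := by
  have h1 : i % (n + 1) = i := Nat.mod_eq_of_lt (by omega)
  have h2 : (i + 1) % (n + 1) = i + 1 := Nat.mod_eq_of_lt (by omega)
  set e : Fin (n + 1) × Fin (n + 1) := (Fin.ofNat (n + 1) i, Fin.ofNat (n + 1) (i + 1)) with he
  have hmem : e ∈ initialEdges n k := by
    simp only [initialEdges, Finset.mem_filter, Finset.mem_univ, true_and, he, Fin.val_ofNat, h1,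
      h2]
    omega
  rw [← Finset.insert_erase hmem, mul_comm (pathY n K _), mul_assoc,
    DS_insert (e := e) (Finset.notMem_erase _ _)]
  · refine DS_mul_eq_zero i (fun f hf => ?_) (fun σ hσ => rename_pathY ?_) ?_
    · have hf1 := (Finset.mem_filter.1 (Finset.mem_of_mem_erase hf)).2
      have hf2 := Finset.ne_of_mem_erase hf
      simp only [he, ne_eq, Prod.ext_iff, Fin.ext_iff, Fin.val_ofNat, h1, h2] at hf2
      rw [Fin.lt_def]
      omega
    · simpa [h1] using hσ
    · rw [Finset.card_erase_of_mem hmem, card_initialEdges hk]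
      omega
  · simp [he, Fin.lt_def, h1, h2]

lemma succ_mul_pathY {k : ℕ} (hk : k + 1 ≤ n) :
    ((k + 2 : ℕ) : K) • pathY n K (Fin.ofNat (n + 1) k) =
      ∑ i ∈ Finset.range (k + 1), ((i + 1 : ℕ) : K) •
        (X (Fin.ofNat (n + 1) i) - X (Fin.ofNat (n + 1) (i + 1))) +
      ((k + 1 : ℕ) : K) • pathY n K (Fin.ofNat (n + 1) (k + 1)) := by
  induction k with
  | zero =>
    rw [pathY_succ hk, zero_add, Finset.sum_range_one]
    simp only [Fin.ofNat_zero, pathY_zero, Nat.cast_smul_eq_nsmul,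
      nsmul_eq_mul]
    push_cast
    ring
  | succ k ih =>
    have ih := ih (by omega)
    rw [Finset.sum_range_succ, pathY_succ hk]
    rw [← sub_eq_iff_eq_add] at ih
    rw [← ih, pathY_succ (by omega : k + 1 ≤ n)]
    simp only [Nat.cast_smul_eq_nsmul, nsmul_eq_mul]
    push_cast
    ring

lemma DS_prod_pathY_succ {k : ℕ} (hk : k + 1 ≤ n) :
    ((k + 2 : ℕ) : K) • DS (initialEdges n (k + 1))
        (∏ i ∈ Finset.range (k + 1), pathY n K (Fin.ofNat (n + 1) i)) =
      ((k + 1 : ℕ) : K) • DS (initialEdges n k)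
        (∏ i ∈ Finset.range k, pathY n K (Fin.ofNat (n + 1) i)) := by
  have hdeg (s : Finset ℕ) := totalDegree_prod_pathY_le (K := K) s (Fin.ofNat (n + 1))
  rw [← dsLinear_apply, ← map_smul, Finset.prod_range_succ, ← mul_smul_comm, succ_mul_pathY hk,
    mul_add, map_add, mul_smul_comm, map_smul, dsLinear_apply, dsLinear_apply,
    mul_comm _ (pathY _ _ _), DS_pathY_mul_eq_zero hk, smul_zero, add_zero, ← dsLinear_apply,
    Finset.mul_sum, map_sum, Finset.sum_range_succ, Finset.sum_eq_zero, zero_add, mul_smul_comm,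
    map_smul, dsLinear_apply, mul_comm, initialEdges_succ hk]
  · have h1 : k % (n + 1) = k := Nat.mod_eq_of_lt (by omega)
    have h2 : (k + 1) % (n + 1) = k + 1 := Nat.mod_eq_of_lt (by omega)
    congr 1
    refine DS_insert (e := (Fin.ofNat (n + 1) k, Fin.ofNat (n + 1) (k + 1))) ?_ ?_ _
    · simp [initialEdges, h2]
    · simp [Fin.lt_def, h1, h2]
  · intro i hi
    rw [mul_smul_comm, map_smul, ← Finset.mul_prod_erase _ _ hi, mul_right_comm, dsLinear_apply,
      DS_pathY_mul_sub_mul_eq_zero, smul_zero]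
    · have := Finset.mem_range.1 hi
      omega
    · exact hk
    · have h1 := hdeg ((Finset.range k).erase i)
      have h2 := Finset.card_erase_of_mem hi
      have := Finset.mem_range.1 hi
      rw [Finset.card_range] at h2
      omega
  · have h1 := hdeg (Finset.range k)
    rw [Finset.card_range] at h1
    omega

lemma DS_prod_pathY [CharZero K] :
    DS (pathEdges n) (∏ j ∈ Finset.univ.erase (Fin.last n), pathY n K j) = n.factorial := by
  have key : ∀ k ≤ n, ((k + 1 : ℕ) : K) • DS (initialEdges n k)
      (∏ i ∈ Finset.range k, pathY n K (Fin.ofNat (n + 1) i)) = (n + 1).factorial := by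
    intro k
    induction k with
    | zero =>
      intro _
      simp [DS, initialEdges_zero, Finset.card_univ, Fintype.card_perm]
    | succ k ih =>
      intro hk
      rw [DS_prod_pathY_succ hk, ih (by omega)]
  have h := key n le_rfl
  have hprod : ∏ i ∈ Finset.range n, pathY n K (Fin.ofNat (n + 1) i) =
      ∏ j ∈ Finset.univ.erase (Fin.last n), pathY n K j := by
    refine Finset.prod_bij' (fun i _ => Fin.ofNat (n + 1) i) (fun j _ => j.val) ?_ ?_ ?_ ?_ ?_
    · intro i hi
      have hi := Finset.mem_range.1 hi
      have : i % (n + 1) = i := Nat.mod_eq_of_lt (by omega)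
      simp [Fin.ext_iff, this]
      omega
    · intro j hj
      have := Finset.ne_of_mem_erase hj
      rw [ne_eq, Fin.ext_iff, Fin.val_last] at this
      rw [Finset.mem_range]
      omega
    · intro i hi
      have hi := Finset.mem_range.1 hi
      exact Nat.mod_eq_of_lt (by omega)
    · intro j _
      simp
    · intro _ _
      rfl
  rw [hprod, ← pathEdges_eq_initialEdges, Nat.cast_smul_eq_nsmul, nsmul_eq_mul, Nat.factorial_succ,
    Nat.cast_mul] at h
  exact mul_left_cancel₀ (Nat.cast_ne_zero.2 n.succ_ne_zero) h

lemma DS_pathY_last_mul_eq_zero {g : MvPolynomial (Fin (n + 1)) K} (hg : g.totalDegree < n) :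
    DS (pathEdges n) (pathY n K (Fin.last n) * g) = 0 := by
  have := DS_pathY_mul_eq_zero le_rfl hg
  rwa [← pathEdges_eq_initialEdges,
    show Fin.ofNat (n + 1) n = Fin.last n by ext; simp] at this

/-- The cyclic form of the Klyachko relations. -/
lemma DS_pathY_mul_laplacian_mul_eq_zero (j : Fin (n + 1)) {g : MvPolynomial (Fin (n + 1)) K}
    (hg : g.totalDegree + 1 < n) :
    DS (pathEdges n)
      (pathY n K j * (2 • pathY n K j - pathY n K (j - 1) - pathY n K (j + 1)) * g) = 0 := by
  obtain ⟨i, hi, rfl⟩ : ∃ i ≤ n, j = Fin.ofNat (n + 1) i := ⟨j.val, by omega, by simp⟩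
  have hsucc (t : ℕ) : Fin.ofNat (n + 1) (t + 1) = Fin.ofNat (n + 1) t + 1 := by
    ext
    simp [Fin.val_add]
  rcases hi.eq_or_lt with rfl | hi
  · have : Fin.ofNat (i + 1) i = Fin.last i := by ext; simp
    rw [this, mul_assoc, DS_pathY_last_mul_eq_zero]
    refine (totalDegree_mul _ _).trans_lt ?_
    have h1 : (2 • pathY i K (Fin.last i) - pathY i K (Fin.last i - 1) -
        pathY i K (Fin.last i + 1)).totalDegree ≤ 1 := by
      refine (totalDegree_sub _ _).trans (max_le ((totalDegree_sub _ _).trans (max_le ?_ ?_)) ?_)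
      · exact (totalDegree_smul_le _ _).trans (totalDegree_pathY_le _)
      · exact totalDegree_pathY_le _
      · exact totalDegree_pathY_le _
    omega
  · have hrel := DS_pathY_mul_sub_mul_eq_zero (K := K) hi le_rfl hg
    rw [← pathEdges_eq_initialEdges] at hrel
    rw [← hsucc i, pathY_succ hi]
    cases i with
    | zero =>
      have hlast : (Fin.ofNat (n + 1) 0 : Fin (n + 1)) - 1 = Fin.last n := by
        rw [sub_eq_iff_eq_add, Fin.last_add_one]; rfl
      have hz : DS (pathEdges n) (pathY n K (Fin.last n) * (pathY n K (Fin.ofNat (n + 1) 0) * g))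
          = 0 := by
        refine DS_pathY_last_mul_eq_zero ((totalDegree_mul _ _).trans_lt ?_)
        have := totalDegree_pathY_le (K := K) (Fin.ofNat (n + 1) 0)
        omega
      rw [hlast, ← dsLinear_apply]
      rw [← dsLinear_apply] at hrel hz
      refine Eq.trans ?_ ((congrArg₂ (· - ·) hrel hz).trans (sub_zero 0))
      rw [← map_sub]
      congr 1
      simp only [Fin.ofNat_zero, pathY_zero]
      ring
    | succ i =>
      rw [show Fin.ofNat (n + 1) (i + 1) - 1 = Fin.ofNat (n + 1) i by
        rw [hsucc, add_sub_cancel_right]]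
      refine Eq.trans (congrArg _ ?_) hrel
      rw [pathY_succ (by omega : i + 1 ≤ n)]
      ring

/-- The cyclically symmetrized monomial in the `y_j` attached to a word in the indices. -/
noncomputable def cyclicMonomial (K : Type*) [Field K] {n : ℕ} (w : Fin n → Fin (n + 1)) :
    MvPolynomial (Fin (n + 1)) K :=
  ∑ i : Fin (n + 1), ∏ k, pathY n K (i + w k)

lemma DS_cyclicMonomial_of_injective [CharZero K] {w : Fin n → Fin (n + 1)}
    (hw : Function.Injective w) : DS (pathEdges n) (cyclicMonomial K w) = n.factorial := by
  obtain ⟨p, hp⟩ : ∃ p, Finset.univ.image w = Finset.univ.erase p := by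
    have hcard : (Finset.univ.image w)ᶜ.card = 1 := by
      rw [Finset.card_compl, Finset.card_image_of_injective _ hw]
      simp
    obtain ⟨p, hp⟩ := Finset.card_eq_one.1 hcard
    exact ⟨p, by rw [← compl_compl (Finset.univ.image w), hp]; ext; simp⟩
  have hprod (i : Fin (n + 1)) : ∏ k, pathY n K (i + w k) =
      ∏ j ∈ Finset.univ.erase (i + p), pathY n K j := by
    rw [← Finset.prod_image (f := fun j => pathY n K (i + j)) hw.injOn, hp]
    exact Finset.prod_equiv (Equiv.addLeft i) (by simp) (by simp)
  have hsum : cyclicMonomial K w = ∑ q, ∏ j ∈ Finset.univ.erase q, pathY n K j :=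
    Fintype.sum_equiv (Equiv.addRight p) _ _ hprod
  rw [hsum, ← dsLinear_apply, map_sum,
    Finset.sum_eq_single (Fin.last n), dsLinear_apply, DS_prod_pathY]
  · intro q _ hq
    have hmem : Fin.last n ∈ Finset.univ.erase q := by simpa using hq.symm
    rw [← Finset.mul_prod_erase _ _ hmem, dsLinear_apply, DS_pathY_last_mul_eq_zero]
    refine (totalDegree_prod_pathY_le _ (fun j => j)).trans_lt ?_
    rw [Finset.card_erase_of_mem hmem, Finset.card_erase_of_mem (Finset.mem_univ _),
      Finset.card_univ, Fintype.card_fin]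
    have : n ≠ 0 := by
      rintro rfl
      exact hq (by ext; omega)
    omega
  · simp

lemma DS_cyclicMonomial_update {w : Fin n → Fin (n + 1)} {k l : Fin n} (hkl : l ≠ k) :
    2 * DS (pathEdges n) (cyclicMonomial K (Function.update w k (w l))) =
      DS (pathEdges n) (cyclicMonomial K (Function.update w k (w l - 1))) +
      DS (pathEdges n) (cyclicMonomial K (Function.update w k (w l + 1))) := by
  have hmem : l ∈ Finset.univ.erase k := by simpa using hkl
  have hupd (a i : Fin (n + 1)) : ∏ x, pathY n K (i + Function.update w k a x) =
      pathY n K (i + a) * (pathY n K (i + w l) *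
        ∏ x ∈ (Finset.univ.erase k).erase l, pathY n K (i + w x)) := by
    rw [Finset.mul_prod_erase _ (fun x => pathY n K (i + w x)) hmem,
      ← Finset.mul_prod_erase _ _ (Finset.mem_univ k), Function.update_self]
    congr 1
    refine Finset.prod_congr rfl fun x hx => ?_
    rw [Function.update_of_ne (Finset.ne_of_mem_erase hx)]
  simp only [← dsLinear_apply, cyclicMonomial, hupd, map_sum, Finset.mul_sum,
    ← Finset.sum_add_distrib]
  refine Finset.sum_congr rfl fun i _ => ?_
  have hcard : ((Finset.univ.erase k).erase l).card + 1 < n := by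
    have h1 := Finset.card_erase_of_mem hmem
    have h2 := Finset.card_erase_of_mem (Finset.mem_univ k)
    have h3 := Finset.card_pos.2 ⟨l, hmem⟩
    rw [Finset.card_univ, Fintype.card_fin] at h2
    omega
  have h := DS_pathY_mul_laplacian_mul_eq_zero (K := K) (i + w l)
    (g := ∏ x ∈ (Finset.univ.erase k).erase l, pathY n K (i + w x))
    (by have := totalDegree_prod_pathY_le (K := K) ((Finset.univ.erase k).erase l)
          (fun x => i + w x)
        omega)
  rw [← dsLinear_apply] at h
  rw [← sub_eq_zero, ← h, two_mul, ← map_add, ← map_add, ← map_sub]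
  congr 1
  rw [← add_sub_assoc, ← add_assoc]
  ring

lemma DS_cyclicMonomial [CharZero K] (w : Fin n → Fin (n + 1)) :
    DS (pathEdges n) (cyclicMonomial K w) = n.factorial := by
  induction h : n - (Finset.univ.image w).card using Nat.strong_induction_on generalizing w with
  | _ d ih =>
    by_cases hw : Function.Injective w
    · exact DS_cyclicMonomial_of_injective hw
    obtain ⟨k, l, hwkl, hkl⟩ : ∃ k l, w k = w l ∧ k ≠ l := by
      simpa [Function.Injective] using hw
    have hnew (j : Fin (n + 1)) (hj : j ∉ Finset.univ.image w) :
        DS (pathEdges n) (cyclicMonomial K (Function.update w k j)) = n.factorial := by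
      refine ih _ ?_ _ rfl
      have hsub : insert j (Finset.univ.image w) ⊆
          Finset.univ.image (Function.update w k j) := by
        intro a ha
        rw [Finset.mem_image]
        rcases Finset.mem_insert.1 ha with rfl | ha
        · exact ⟨k, Finset.mem_univ _, Function.update_self ..⟩
        · obtain ⟨x, -, rfl⟩ := Finset.mem_image.1 ha
          rcases eq_or_ne x k with rfl | hx
          · exact ⟨l, Finset.mem_univ _, by rw [Function.update_of_ne hkl.symm, hwkl]⟩
          · exact ⟨x, Finset.mem_univ _, Function.update_of_ne hx ..⟩
      have h1 := Finset.card_le_card hsub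
      rw [Finset.card_insert_of_notMem hj] at h1
      have h2 : (Finset.univ.image (Function.update w k j)).card ≤ n :=
        Finset.card_image_le.trans (by simp)
      omega
    obtain ⟨p, hp⟩ : ∃ p, p ∉ Finset.univ.image w := by
      by_contra! hall
      have h1 : (Finset.univ.image w).card ≤ n := Finset.card_image_le.trans (by simp)
      rw [Finset.eq_univ_iff_forall.2 hall, Finset.card_univ, Fintype.card_fin] at h1
      omega
    rw [← Function.update_eq_self k w]
    refine eq_of_harmonic_cycle
      (h := fun j => DS (pathEdges n) (cyclicMonomial K (Function.update w k j))) (hnew p hp)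
      (fun j => ?_) (w k)
    by_cases hj : j ∈ Finset.univ.image w
    · right
      obtain ⟨x, -, rfl⟩ := Finset.mem_image.1 hj
      rcases eq_or_ne x k with rfl | hx
      · rw [hwkl]
        exact DS_cyclicMonomial_update hkl.symm
      · exact DS_cyclicMonomial_update hx
    · exact Or.inl (hnew j hj)

end PathY

/-- Postnikov's Corollary 6.5: for the path `G` on `x_0, …, x_n`,
`Φ = DS_G`, and `y_i = x_0 + ⋯ + x_i`: for any scalars `z_0, …, z_n`,
`Φ(Σ_{i=0}^{n} (z_0 y_i + z_1 y_{i+1} + ⋯ + z_n y_{i+n})^n) = n! · (z_0 + ⋯ + z_n)^n`,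
the indices of `y` being taken modulo `n + 1`. -/
theorem postnikov_corollary {K : Type*} [Field K] [CharZero K] (n : ℕ)
    (z : Fin (n + 1) → K) :
    DS (pathEdges n)
        (∑ i : Fin (n + 1), (∑ j : Fin (n + 1), C (z j) * pathY n K (i + j)) ^ n) =
      (n.factorial : FractionRing (MvPolynomial (Fin (n + 1)) K)) *
        algebraMap (MvPolynomial (Fin (n + 1)) K) (FractionRing (MvPolynomial (Fin (n + 1)) K))
          (C ((∑ j : Fin (n + 1), z j) ^ n)) := by
  have hexp : ∑ i : Fin (n + 1), (∑ j : Fin (n + 1), C (z j) * pathY n K (i + j)) ^ n =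
      ∑ w : Fin n → Fin (n + 1), (∏ k, z (w k)) • cyclicMonomial K w := by
    simp only [Fintype.sum_pow, cyclicMonomial, Finset.smul_sum]
    rw [Finset.sum_comm]
    refine Finset.sum_congr rfl fun w _ => Finset.sum_congr rfl fun i _ => ?_
    rw [Finset.prod_mul_distrib, ← map_prod, smul_eq_C_mul]
  rw [hexp, ← dsLinear_apply, map_sum, Fintype.sum_pow, map_sum, map_sum, Finset.mul_sum]
  refine Finset.sum_congr rfl fun w _ => ?_
  rw [map_smul, dsLinear_apply, DS_cyclicMonomial, Algebra.smul_def, mul_comm,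
    IsScalarTower.algebraMap_apply K (MvPolynomial (Fin (n + 1)) K), algebraMap_eq]
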